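/- Let π = π(x,t) be a smooth positive function, h a smooth scalar function with π u = −∇h defining the vector field u, and let φ be a smooth scalar function. Then pointwise: u · ∇(u · ∇φ) = (∇²φ) u · u + (1/2) ∇|u|² · ∇φ + (1/π) ((∇π · ∇φ) |u|² − (u · ∇π)(u · ∇φ)), where ∇²φ denotes the Hessian matrix of φ. -/

import Mathlib

open MeasureTheory Filter
open scoped RealInnerProductSpace Topology

noncomputable section

/-- The unit cube `Ω = [0,1)^n ⊂ ℝ^n`. -/
def cube (n : ℕ) : Set (EuclideanSpace ℝ (Fin n)) :=
  {x | ∀ i, x i ∈ Set.Ico (0 : ℝ) 1}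

theorem aux_gradient_contDiff {n : ℕ} {f : EuclideanSpace ℝ (Fin n) → ℝ}
    (hf : ContDiff ℝ (⊤ : ℕ∞) f) : ContDiff ℝ (⊤ : ℕ∞) (fun y => gradient f y) := by
  have h1 : ContDiff ℝ (⊤ : ℕ∞) (fderiv ℝ f) := hf.fderiv_right (by simp)
  exact ((InnerProductSpace.toDual ℝ (EuclideanSpace ℝ (Fin n))).symm.contDiff).comp h1

theorem aux_inner_gradient {n : ℕ} (f : EuclideanSpace ℝ (Fin n) → ℝ)
    (x v : EuclideanSpace ℝ (Fin n)) : ⟪gradient f x, v⟫ = fderiv ℝ f x v := by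
  simp [gradient]

theorem aux_hess_symm {n : ℕ} {f : EuclideanSpace ℝ (Fin n) → ℝ}
    (hf : ContDiff ℝ (⊤ : ℕ∞) f) (x v w : EuclideanSpace ℝ (Fin n)) :
    ⟪fderiv ℝ (fun y => gradient f y) x v, w⟫ = ⟪fderiv ℝ (fun y => gradient f y) x w, v⟫ := by
  have hd : DifferentiableAt ℝ (fun y => gradient f y) x :=
    (aux_gradient_contDiff hf).differentiable (by simp) x
  have h1 : ContDiff ℝ (⊤ : ℕ∞) (fderiv ℝ f) := hf.fderiv_right (by simp)
  have hd1 : DifferentiableAt ℝ (fderiv ℝ f) x := h1.differentiable (by simp) x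
  have key : ∀ v w, ⟪fderiv ℝ (fun y => gradient f y) x v, w⟫ = fderiv ℝ (fderiv ℝ f) x v w := by
    intro v w
    have e : (fun y => ⟪gradient f y, w⟫) = fun y => fderiv ℝ f y w :=
      funext fun y => aux_inner_gradient f y w
    have e1 := fderiv_inner_apply ℝ hd (differentiableAt_const w) v
    rw [e, fderiv_clm_apply hd1 (differentiableAt_const w)] at e1
    simpa using e1.symm
  rw [key, key]
  have hs : IsSymmSndFDerivAt ℝ f x :=
    hf.contDiffAt.isSymmSndFDerivAt (by simp; exact WithTop.coe_le_coe.2 (le_top : (2 : ℕ∞) ≤ ⊤))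
  exact hs v w

/-- **Pointwise identity for `u · ∇(u · ∇φ)` (Lemma 4.10).**  Let `π` be a smooth positive
function, `h` a smooth scalar function with `π u = -∇h` defining the vector field `u`, and
`φ` a smooth scalar function.  Then pointwise
`u · ∇(u · ∇φ) = (∇²φ) u · u + (1/2) ∇|u|² · ∇φ
  + (1/π)((∇π · ∇φ)|u|² - (u · ∇π)(u · ∇φ))`,
where `∇²φ` is the Hessian of `φ`. -/
theorem transport_hessian_identity
    {n : ℕ}
    (π h : EuclideanSpace ℝ (Fin n) → ℝ → ℝ)
    (φ : EuclideanSpace ℝ (Fin n) → ℝ)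
    (u : EuclideanSpace ℝ (Fin n) → ℝ → EuclideanSpace ℝ (Fin n))
    -- `π` is a smooth positive function, `h` and `φ` are smooth scalar functions
    (hπpos : ∀ x t, 0 < t → 0 < π x t)
    (hπsmooth : ∀ t : ℝ, 0 < t → ContDiff ℝ (⊤ : ℕ∞) fun x => π x t)
    (hhsmooth : ∀ t : ℝ, 0 < t → ContDiff ℝ (⊤ : ℕ∞) fun x => h x t)
    (hφsmooth : ContDiff ℝ (⊤ : ℕ∞) φ)
    -- the vector field `u` is defined by `π u = -∇h`
    (hu : ∀ x t, (π x t) • u x t = -gradient (fun y => h y t) x) :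
    ∀ (x : EuclideanSpace ℝ (Fin n)) (t : ℝ), 0 < t →
      ⟪u x t, gradient (fun y => ⟪u y t, gradient φ y⟫) x⟫
        = ⟪fderiv ℝ (fun y => gradient φ y) x (u x t), u x t⟫
          + 1 / 2 * ⟪gradient (fun y => ‖u y t‖ ^ 2) x, gradient φ x⟫
          + (π x t)⁻¹ *
              (⟪gradient (fun y => π y t) x, gradient φ x⟫ * ‖u x t‖ ^ 2
                - ⟪u x t, gradient (fun y => π y t) x⟫ * ⟪u x t, gradient φ x⟫) := by
  intro x t ht
  have hπ0 : ∀ y, π y t ≠ 0 := fun y => (hπpos y t ht).ne'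
  have hπd : DifferentiableAt ℝ (fun y => π y t) x := (hπsmooth t ht).differentiable (by simp) x
  have hgd : DifferentiableAt ℝ (fun y => gradient φ y) x :=
    (aux_gradient_contDiff hφsmooth).differentiable (by simp) x
  have hhd : DifferentiableAt ℝ (fun y => gradient (fun z => h z t) y) x :=
    (aux_gradient_contDiff (hhsmooth t ht)).differentiable (by simp) x
  have hueq : (fun y => u y t) = fun y => (π y t)⁻¹ • (-gradient (fun z => h z t) y) := by
    funext y
    rw [← hu y t, smul_smul, inv_mul_cancel₀ (hπ0 y), one_smul]
  have hud : DifferentiableAt ℝ (fun y => u y t) x := by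
    rw [hueq]
    exact (hπd.inv (hπ0 x)).smul hhd.neg
  have hD : ∀ v, π x t • fderiv ℝ (fun y => u y t) x v + fderiv ℝ (fun y => π y t) x v • u x t
      = - fderiv ℝ (fun y => gradient (fun z => h z t) y) x v := by
    intro v
    have e : (fun y => π y t • u y t) = fun y => -gradient (fun z => h z t) y :=
      funext fun y => hu y t
    have e1 := congrArg (fun F => fderiv ℝ F x v) e
    simp only [fderiv_fun_neg] at e1
    rw [fderiv_fun_smul hπd hud] at e1
    simpa using e1
  have hsym := aux_hess_symm (hhsmooth t ht) x (u x t) (gradient φ x)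
  have a1 := congrArg (fun z => ⟪z, gradient φ x⟫) (hD (u x t))
  have a2 := congrArg (fun z => ⟪z, u x t⟫) (hD (gradient φ x))
  simp only [inner_add_left, inner_smul_left, inner_neg_left, conj_trivial] at a1 a2
  have en : (fun y => ‖u y t‖ ^ 2) = fun y => ⟪u y t, u y t⟫ :=
    funext fun y => (real_inner_self_eq_norm_sq _).symm
  rw [real_inner_comm, aux_inner_gradient, en, aux_inner_gradient, aux_inner_gradient,
    fderiv_inner_apply ℝ hud hgd, fderiv_inner_apply ℝ hud hud, ← real_inner_self_eq_norm_sq,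
    real_inner_comm (gradient (fun y => π y t) x) (u x t), aux_inner_gradient,
    real_inner_comm (fderiv ℝ (fun y => u y t) x (gradient φ x)) (u x t),
    real_inner_comm (fderiv ℝ (fun y => gradient φ y) x (u x t)) (u x t)]
  have := hπ0 x
  field_simp
  linarith
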